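/- Let a chain datum on [a,b] satisfy the moment map relations, the stability condition, the ε-condition, and be s-bounded. Then for every i with a ≤ i−s−1 and i+s+1 ≤ b, the space V_i decomposes as the internal direct sum V_i = range Xcomp(s, i+s) ⊕ range Ycomp(s, i−s); moreover range Xcomp(s, i+s) = ker Ycomp(s, i) and range Ycomp(s, i−s) = ker Xcomp(s, i). -/

import Mathlib

/-!
A *chain datum* on an integer interval `[a,b]`: finite-dimensional complex vector
spaces `V j` and linear maps `x j : V j → V (j-1)`, `y j : V (j-1) → V j`.
(The data is given for all `j : ℤ`; all hypotheses and conclusions only refer to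
indices in the interval `[a,b]`.)
-/

variable (V : ℤ → Type) [∀ j, AddCommGroup (V j)] [∀ j, Module ℂ (V j)]
  [∀ j, FiniteDimensional ℂ (V j)]

/-- Transport along an equality of indices. -/
def castV {i j : ℤ} (h : i = j) : V i →ₗ[ℂ] V j := by subst h; exact LinearMap.id

variable (x : ∀ j : ℤ, V j →ₗ[ℂ] V (j - 1)) (y : ∀ j : ℤ, V (j - 1) →ₗ[ℂ] V j)

/-- `Xcomp ℓ i = x_{i-ℓ+1} ∘ ⋯ ∘ x_i : V i → V (i - ℓ)`. -/
def Xcomp : (ℓ : ℕ) → (i : ℤ) → (V i →ₗ[ℂ] V (i - (ℓ : ℤ)))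
  | 0, i => castV V (by simp)
  | (ℓ + 1), i =>
      (castV V (show i - 1 - (ℓ : ℤ) = i - ((ℓ : ℕ) + 1 : ℕ) by push_cast; ring)).comp
        ((Xcomp ℓ (i - 1)).comp (x i))

/-- `Ycomp ℓ i = y_{i+ℓ} ∘ ⋯ ∘ y_{i+1} : V i → V (i + ℓ)`. -/
def Ycomp : (ℓ : ℕ) → (i : ℤ) → (V i →ₗ[ℂ] V (i + (ℓ : ℤ)))
  | 0, i => castV V (by simp)
  | (ℓ + 1), i =>
      (castV V (show i + 1 + (ℓ : ℤ) = i + ((ℓ : ℕ) + 1 : ℕ) by push_cast; ring)).comp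
        ((Ycomp ℓ (i + 1)).comp ((y (i + 1)).comp (castV V (show i = i + 1 - 1 by ring))))

/-- The moment map relations `y_j ∘ x_j = x_{j+1} ∘ y_{j+1}` for `a < j < b`. -/
def MomentMap (a b : ℤ) : Prop :=
  ∀ j : ℤ, a < j → j < b →
    (y j).comp (x j) =
      (castV V (show j + 1 - 1 = j by ring)).comp
        ((x (j + 1)).comp ((y (j + 1)).comp (castV V (show j = j + 1 - 1 by ring))))

/-- The stability condition: `ker x_p ∩ ker y_{p+1} = 0` for `a < p < b`. -/
def Stability (a b : ℤ) : Prop :=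
  ∀ p : ℤ, a < p → p < b →
    LinearMap.ker (x p) ⊓
      LinearMap.ker ((y (p + 1)).comp (castV V (show p = p + 1 - 1 by ring))) = ⊥

/-- The ε-condition: `V_p = range x_{p+1} + range y_p` for `a < p < b`. -/
def EpsCond (a b : ℤ) : Prop :=
  ∀ p : ℤ, a < p → p < b →
    LinearMap.range ((castV V (show p + 1 - 1 = p by ring)).comp (x (p + 1))) ⊔
      LinearMap.range (y p) = ⊤

/-- `s`-boundedness: each `y_j ∘ x_j` is nilpotent and `dim V_j ≤ s` on `[a,b]`. -/
def SBounded (s : ℕ) (a b : ℤ) : Prop :=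
  (∀ j : ℤ, a < j → j ≤ b → IsNilpotent ((y j).comp (x j) : Module.End ℂ (V j))) ∧
  (∀ j : ℤ, a ≤ j → j ≤ b → Module.finrank ℂ (V j) ≤ s)

section

variable (U : ℤ → Type) [∀ j, AddCommGroup (U j)] [∀ j, Module ℂ (U j)]

lemma castV_rfl {i : ℤ} (h : i = i) (v : U i) : castV U h v = v := rfl

lemma castV_castV {i j k : ℤ} (h : i = j) (h' : j = k) (v : U i) :
    castV U h' (castV U h v) = castV U (h.trans h') v := by
  subst h h'; rfl

lemma castV_apply_pi (f : ∀ j, U j) {i j : ℤ} (h : i = j) : castV U h (f i) = f j := by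
  subst h; rfl

variable (x : ∀ j : ℤ, U j →ₗ[ℂ] U (j - 1)) (y : ∀ j : ℤ, U (j - 1) →ₗ[ℂ] U j)

/-- The lowering operator on `∏ j, U j` assembled from all the maps `x j`. -/
def totalX : Module.End ℂ (∀ j, U j) :=
  LinearMap.pi fun j =>
    (castV U (show j + 1 - 1 = j by ring)).comp ((x (j + 1)).comp (LinearMap.proj (j + 1)))

/-- The raising operator on `∏ j, U j` assembled from all the maps `y j`. -/
def totalY : Module.End ℂ (∀ j, U j) :=
  LinearMap.pi fun j => (y j).comp (LinearMap.proj (j - 1))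

lemma totalX_apply (f : ∀ j, U j) {j k : ℤ} (h : k - 1 = j) :
    totalX U x f j = castV U h (x k (f k)) := by
  obtain rfl : k = j + 1 := by omega
  rfl

lemma totalX_apply_sub_one (f : ∀ j, U j) (k : ℤ) : totalX U x f (k - 1) = x k (f k) :=
  totalX_apply U x f rfl

lemma totalY_apply (f : ∀ j, U j) (j : ℤ) : totalY U y f j = y j (f (j - 1)) := rfl

lemma totalY_apply_add_one (f : ∀ j, U j) (j : ℤ) :
    totalY U y f (j + 1) = y (j + 1) (castV U (show j = j + 1 - 1 by ring) (f j)) := by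
  rw [totalY_apply, castV_apply_pi]

lemma totalX_pow_congr (n : ℕ) {f g : ∀ j, U j} {j k : ℤ} (hk : k = j + n) (h : f k = g k) :
    (totalX U x ^ n) f j = (totalX U x ^ n) g j := by
  induction n generalizing f g k with
  | zero =>
    obtain rfl : k = j := by simpa using hk
    simpa using h
  | succ n ih =>
    simp only [pow_succ, Module.End.mul_apply]
    refine ih (k := k - 1) (by push_cast at hk; omega) ?_
    rw [totalX_apply_sub_one, totalX_apply_sub_one, h]

lemma totalY_pow_congr (n : ℕ) {f g : ∀ j, U j} {j k : ℤ} (hk : k = j - n) (h : f k = g k) :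
    (totalY U y ^ n) f j = (totalY U y ^ n) g j := by
  induction n generalizing f g k with
  | zero =>
    obtain rfl : k = j := by simpa using hk
    simpa using h
  | succ n ih =>
    simp only [pow_succ, Module.End.mul_apply]
    refine ih (k := k + 1) (by push_cast at hk; omega) ?_
    rw [totalY_apply_add_one, totalY_apply_add_one, h]

lemma castV_Xcomp (n : ℕ) (f : ∀ j, U j) {k j : ℤ} (h : k - n = j) :
    castV U h (Xcomp U x n k (f k)) = (totalX U x ^ n) f j := by
  induction n generalizing f k with
  | zero =>
    obtain rfl : k = j := by simpa using h
    simp only [Xcomp, castV_castV, castV_rfl, pow_zero, Module.End.one_apply]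
  | succ n ih =>
    simp only [Xcomp, LinearMap.comp_apply, castV_castV, pow_succ, Module.End.mul_apply]
    rw [← totalX_apply_sub_one, ih]

lemma castV_Ycomp (n : ℕ) (f : ∀ j, U j) {k j : ℤ} (h : k + n = j) :
    castV U h (Ycomp U y n k (f k)) = (totalY U y ^ n) f j := by
  induction n generalizing f k with
  | zero =>
    obtain rfl : k = j := by simpa using h
    simp only [Ycomp, castV_castV, castV_rfl, pow_zero, Module.End.one_apply]
  | succ n ih =>
    simp only [Ycomp, LinearMap.comp_apply, castV_castV, pow_succ, Module.End.mul_apply]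
    rw [← totalY_apply_add_one, ih]

variable {U x y} {a b : ℤ}

lemma MomentMap.totalX_totalY (hmm : MomentMap U x y a b) (f : ∀ j, U j) {j : ℤ}
    (ha : a < j) (hb : j < b) :
    totalX U x (totalY U y f) j = totalY U y (totalX U x f) j := by
  have h := LinearMap.congr_fun (hmm j ha hb) (f j)
  simp only [LinearMap.comp_apply] at h
  rw [totalY_apply, totalX_apply_sub_one, h, ← totalY_apply_add_one]
  rfl

lemma MomentMap.totalX_totalY_pow (hmm : MomentMap U x y a b) (q : ℕ) (f : ∀ j, U j) {j : ℤ}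
    (ha : a < j - q) (hb : j < b) :
    totalX U x ((totalY U y ^ q) f) j = (totalY U y ^ q) (totalX U x f) j := by
  induction q generalizing f with
  | zero => simp
  | succ q ih =>
    push_cast at ha
    simp only [pow_succ, Module.End.mul_apply]
    rw [ih _ (by omega)]
    exact totalY_pow_congr U y q rfl (hmm.totalX_totalY f (by omega) (by omega))

lemma MomentMap.totalX_pow_totalY_pow (hmm : MomentMap U x y a b) (p q : ℕ) (f : ∀ j, U j)
    {j : ℤ} (ha : a < j - q) (hb : j + p ≤ b) :
    (totalX U x ^ p) ((totalY U y ^ q) f) j = (totalY U y ^ q) ((totalX U x ^ p) f) j := by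
  induction p generalizing f with
  | zero => simp
  | succ p ih =>
    push_cast at hb
    simp only [pow_succ, Module.End.mul_apply]
    rw [← ih _ (by omega)]
    exact totalX_pow_congr U x p rfl (hmm.totalX_totalY_pow q f (by omega) (by omega))

lemma MomentMap.totalX_pow_totalY_pow_self (hmm : MomentMap U x y a b) (n : ℕ) (f : ∀ j, U j)
    {k : ℤ} (ha : a < k) (hb : k + n ≤ b) :
    (totalX U x ^ n) ((totalY U y ^ n) f) k =
      (((y k).comp (x k) : Module.End ℂ (U k)) ^ n) (f k) := by
  induction n generalizing f with
  | zero => simp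
  | succ n ih =>
    push_cast at hb
    have h := hmm.totalX_totalY_pow n (totalY U y f) (j := k + n) (by omega) (by omega)
    rw [pow_succ, pow_succ, pow_succ]
    simp only [Module.End.mul_apply]
    rw [totalX_pow_congr U x n rfl h, ih _ (by omega), hmm.totalX_totalY f ha (by omega),
      totalY_apply, totalX_apply_sub_one]
    rfl

lemma MomentMap.totalY_pow_totalX_pow_self (hmm : MomentMap U x y a b) (n : ℕ) (f : ∀ j, U j)
    {k : ℤ} (ha : a < k - n) (hb : k ≤ b) :
    (totalY U y ^ n) ((totalX U x ^ n) f) k =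
      (((y k).comp (x k) : Module.End ℂ (U k)) ^ n) (f k) := by
  induction n generalizing f with
  | zero => simp
  | succ n ih =>
    push_cast at ha
    have h := hmm.totalX_pow_totalY_pow n 1 (totalX U x f) (j := k - n) (by push_cast; omega)
      (by omega)
    rw [pow_one] at h
    rw [pow_succ (totalY U y), pow_succ (totalX U x), pow_succ]
    simp only [Module.End.mul_apply]
    rw [totalY_pow_congr U y n rfl h.symm, ih _ (by omega), totalY_apply, totalX_apply_sub_one]
    rfl

lemma Stability.eq_zero (hst : Stability U x y a b) {f : ∀ j, U j} {p : ℤ} (ha : a < p)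
    (hb : p < b) (hx : totalX U x f (p - 1) = 0) (hy : totalY U y f (p + 1) = 0) : f p = 0 := by
  have h : f p ∈ LinearMap.ker (x p) ⊓
      LinearMap.ker ((y (p + 1)).comp (castV U (show p = p + 1 - 1 by ring))) :=
    ⟨by rwa [totalX_apply_sub_one] at hx, by rwa [totalY_apply_add_one] at hy⟩
  rwa [hst p ha hb, Submodule.mem_bot] at h

lemma EpsCond.exists_eq_add (heps : EpsCond U x y a b) {p : ℤ} (ha : a < p) (hb : p < b)
    (v : U p) : ∃ g h : ∀ j, U j, v = totalX U x g p + totalY U y h p := by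
  have hv : v ∈ (⊤ : Submodule ℂ (U p)) := trivial
  rw [← heps p ha hb, Submodule.mem_sup] at hv
  obtain ⟨_, ⟨u, rfl⟩, _, ⟨w, rfl⟩, rfl⟩ := hv
  refine ⟨Pi.single _ u, Pi.single _ w, ?_⟩
  rw [totalX_apply U x _ (add_sub_cancel_right p 1), totalY_apply, Pi.single_eq_same,
    Pi.single_eq_same]
  rfl

lemma Stability.eq_zero_of_totalX_pow_of_totalY_pow (hst : Stability U x y a b)
    (hmm : MomentMap U x y a b) {s : ℕ} {i : ℤ} (ha : a < i - s) (hb : i + s < b)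
    {f : ∀ j, U j} (hX : (totalX U x ^ s) f (i - s) = 0)
    (hY : (totalY U y ^ s) f (i + s) = 0) : f i = 0 := by
  have key : ∀ n p q : ℕ, p ≤ s → q ≤ s → 2 * s ≤ n + p + q →
      ∀ j : ℤ, j = i - p + q → (totalX U x ^ p) ((totalY U y ^ q) f) j = 0 := by
    intro n
    induction n with
    | zero =>
      rintro p q hp hq hn j rfl
      obtain rfl : q = s := by omega
      rw [totalX_pow_congr U x p (g := 0) (k := i + q) (by ring) hY, map_zero, Pi.zero_apply]
    | succ n ih =>
      rintro p q hp hq hn j rfl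
      rcases hq.eq_or_lt with rfl | hq'
      · rw [totalX_pow_congr U x p (g := 0) (k := i + q) (by ring) hY, map_zero, Pi.zero_apply]
      rcases hp.eq_or_lt with rfl | hp'
      · rw [hmm.totalX_pow_totalY_pow p q f (by omega) (by omega),
          totalY_pow_congr U y q (g := 0) (k := i - p) (by ring) hX, map_zero, Pi.zero_apply]
      refine hst.eq_zero (by omega) (by omega) ?_ ?_
      · have h := ih (p + 1) q hp' hq (by omega) (i - p + q - 1) (by push_cast; ring)
        rwa [pow_succ', Module.End.mul_apply] at h
      · have h := ih p (q + 1) hp hq' (by omega) (i - p + q + 1) (by push_cast; ring)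
        have hc := hmm.totalX_pow_totalY_pow p 1 ((totalY U y ^ q) f) (j := i - p + q + 1)
          (by push_cast; omega) (by omega)
        rw [pow_succ', Module.End.mul_apply] at h
        rw [pow_one] at hc
        rw [← hc, h]
  simpa using key (2 * s) 0 0 (by omega) (by omega) (by omega) i (by simp)

lemma EpsCond.exists_eq_totalX_pow_add_totalY_pow (heps : EpsCond U x y a b)
    (hmm : MomentMap U x y a b) {s : ℕ} {i : ℤ} (ha : a < i - s) (hb : i + s < b) (v : U i) :
    ∃ g h : ∀ j, U j, v = (totalX U x ^ s) g i + (totalY U y ^ s) h i := by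
  have key : ∀ n p q : ℕ, p ≤ s → q ≤ s → 2 * s ≤ n + p + q → ∀ f : ∀ j, U j,
      ∃ g h : ∀ j, U j, (totalX U x ^ p) ((totalY U y ^ q) f) i =
        (totalX U x ^ s) g i + (totalY U y ^ s) h i := by
    intro n
    induction n with
    | zero =>
      intro p q hp hq hn f
      obtain rfl : p = s := by omega
      exact ⟨(totalY U y ^ q) f, 0, by simp⟩
    | succ n ih =>
      intro p q hp hq hn f
      rcases hp.eq_or_lt with rfl | hp'
      · exact ⟨(totalY U y ^ q) f, 0, by simp⟩
      rcases hq.eq_or_lt with rfl | hq'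
      · refine ⟨0, (totalX U x ^ p) f, ?_⟩
        rw [hmm.totalX_pow_totalY_pow p q f (by omega) (by omega)]
        simp
      obtain ⟨u, w, huw⟩ := heps.exists_eq_add (p := i + p - q) (by omega) (by omega) (f _)
      have hf : (totalX U x ^ p) ((totalY U y ^ q) f) i =
          (totalX U x ^ p) ((totalY U y ^ q) (totalX U x u + totalY U y w)) i :=
        totalX_pow_congr U x p rfl (totalY_pow_congr U y q rfl huw)
      have hc : (totalX U x ^ p) ((totalY U y ^ q) (totalX U x u)) i =
          (totalX U x ^ p) (totalX U x ((totalY U y ^ q) u)) i :=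
        totalX_pow_congr U x p rfl
          (hmm.totalX_totalY_pow q u (by omega) (by omega)).symm
      obtain ⟨g₁, h₁, e₁⟩ := ih (p + 1) q hp' hq (by omega) u
      obtain ⟨g₂, h₂, e₂⟩ := ih p (q + 1) hp hq' (by omega) w
      simp only [pow_succ _ p, pow_succ _ q, Module.End.mul_apply] at e₁ e₂
      refine ⟨g₁ + g₂, h₁ + h₂, ?_⟩
      rw [hf, map_add, map_add, Pi.add_apply, hc, e₁, e₂]
      simp only [map_add, Pi.add_apply]
      abel
  simpa using key (2 * s) 0 0 (by omega) (by omega) (by omega) (Pi.single i v)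

variable (U x y)

lemma mem_range_Xcomp {n : ℕ} {i : ℤ} (h : i + (n : ℤ) - n = i) {v : U i} :
    v ∈ LinearMap.range ((castV U h).comp (Xcomp U x n (i + n))) ↔
      ∃ f : ∀ j, U j, (totalX U x ^ n) f i = v := by
  constructor
  · rintro ⟨u, rfl⟩
    refine ⟨Pi.single _ u, ?_⟩
    rw [← castV_Xcomp U x n _ h, Pi.single_eq_same]
    rfl
  · rintro ⟨f, rfl⟩
    exact ⟨f (i + n), castV_Xcomp U x n f h⟩

lemma mem_range_Ycomp {n : ℕ} {i : ℤ} (h : i - (n : ℤ) + n = i) {v : U i} :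
    v ∈ LinearMap.range ((castV U h).comp (Ycomp U y n (i - n))) ↔
      ∃ f : ∀ j, U j, (totalY U y ^ n) f i = v := by
  constructor
  · rintro ⟨u, rfl⟩
    refine ⟨Pi.single _ u, ?_⟩
    rw [← castV_Ycomp U y n _ h, Pi.single_eq_same]
    rfl
  · rintro ⟨f, rfl⟩
    exact ⟨f (i - n), castV_Ycomp U y n f h⟩

lemma apply_mem_ker_Xcomp {n : ℕ} {i : ℤ} {f : ∀ j, U j} :
    f i ∈ LinearMap.ker (Xcomp U x n i) ↔ (totalX U x ^ n) f (i - n) = 0 := by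
  rw [← castV_Xcomp U x n f rfl]
  rfl

lemma apply_mem_ker_Ycomp {n : ℕ} {i : ℤ} {f : ∀ j, U j} :
    f i ∈ LinearMap.ker (Ycomp U y n i) ↔ (totalY U y ^ n) f (i + n) = 0 := by
  rw [← castV_Ycomp U y n f rfl]
  rfl

end

variable {V x y} in
lemma SBounded.pow_eq_zero {a b : ℤ} {s : ℕ} (hsb : SBounded V x y s a b) {k : ℤ} (ha : a < k)
    (hb : k ≤ b) : ((y k).comp (x k) : Module.End ℂ (V k)) ^ s = 0 :=
  pow_eq_zero_of_le (hsb.2 k ha.le hb) <| by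
    simpa [(hsb.1 k ha hb).charpoly_eq_X_pow_finrank] using
      LinearMap.aeval_self_charpoly ((y k).comp (x k) : Module.End ℂ (V k))

/-- In a modular lattice, if `r ≤ l`, `t ≤ k`, `r ⊔ t = ⊤` and `k ⊓ l = ⊥`, then `r` and `t` are
complementary and the two inequalities are equalities. -/
lemma isCompl_and_eq_of_le {α : Type*} [Lattice α] [IsModularLattice α] [BoundedOrder α]
    {r t k l : α} (hr : r ≤ l) (ht : t ≤ k) (hsup : r ⊔ t = ⊤) (hinf : k ⊓ l = ⊥) :
    IsCompl r t ∧ r = l ∧ t = k := by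
  have hd : Disjoint k l := disjoint_iff.2 hinf
  refine ⟨⟨hd.symm.mono hr ht, codisjoint_iff.2 hsup⟩, ?_, ?_⟩
  · refine eq_of_le_of_inf_le_of_le_sup (z := t) hr ?_ (hsup ▸ le_top)
    exact (hd.symm.mono_right ht).eq_bot ▸ bot_le
  · refine eq_of_le_of_inf_le_of_le_sup (z := r) ht ?_ (sup_comm r t ▸ hsup ▸ le_top)
    exact (hd.mono_right hr).eq_bot ▸ bot_le

/-- Under the moment map relations, stability, the ε-condition
and `s`-boundedness: for `a ≤ i−s−1` and `i+s+1 ≤ b` the space `V i` is the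
internal direct sum of `range Xcomp(s, i+s)` and `range Ycomp(s, i−s)`; moreover
`range Xcomp(s, i+s) = ker Ycomp(s, i)` and `range Ycomp(s, i−s) = ker Xcomp(s, i)`. -/
theorem statement2 (a b : ℤ) (hab : a < b) (hmm : MomentMap V x y a b)
    (hst : Stability V x y a b) (heps : EpsCond V x y a b)
    (s : ℕ) (hs : 1 ≤ s) (hsb : SBounded V x y s a b)
    (i : ℤ) (h₁ : a ≤ i - s - 1) (h₂ : i + s + 1 ≤ b) :
    IsCompl
        (LinearMap.range ((castV V (show i + (s : ℤ) - (s : ℤ) = i by ring)).comp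
          (Xcomp V x s (i + s))))
        (LinearMap.range ((castV V (show i - (s : ℤ) + (s : ℤ) = i by ring)).comp
          (Ycomp V y s (i - s)))) ∧
    LinearMap.range ((castV V (show i + (s : ℤ) - (s : ℤ) = i by ring)).comp
        (Xcomp V x s (i + s))) = LinearMap.ker (Ycomp V y s i) ∧
    LinearMap.range ((castV V (show i - (s : ℤ) + (s : ℤ) = i by ring)).comp
        (Ycomp V y s (i - s))) = LinearMap.ker (Xcomp V x s i) := by
  have ha : a < i - s := by omega
  have hb : i + s < b := by omega
  refine isCompl_and_eq_of_le ?_ ?_ ?_ ?_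
  · intro v hv
    obtain ⟨f, rfl⟩ := (mem_range_Xcomp V x _).1 hv
    have h := hmm.totalY_pow_totalX_pow_self s f (k := i + s) (by omega) hb.le
    rw [hsb.pow_eq_zero (by omega) hb.le] at h
    exact (apply_mem_ker_Ycomp V y).2 h
  · intro v hv
    obtain ⟨f, rfl⟩ := (mem_range_Ycomp V y _).1 hv
    have h := hmm.totalX_pow_totalY_pow_self s f (k := i - s) ha (by omega)
    rw [hsb.pow_eq_zero ha (by omega)] at h
    exact (apply_mem_ker_Xcomp V x).2 h
  · refine eq_top_iff.2 fun v _ => ?_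
    obtain ⟨g, h, rfl⟩ := heps.exists_eq_totalX_pow_add_totalY_pow hmm ha hb v
    exact Submodule.add_mem_sup ((mem_range_Xcomp V x _).2 ⟨g, rfl⟩)
      ((mem_range_Ycomp V y _).2 ⟨h, rfl⟩)
  · refine eq_bot_iff.2 fun v hv => ?_
    obtain ⟨f, rfl⟩ : ∃ f : ∀ j, V j, f i = v := ⟨Pi.single i v, Pi.single_eq_same i v⟩
    exact hst.eq_zero_of_totalX_pow_of_totalY_pow hmm ha hb
      ((apply_mem_ker_Xcomp V x).1 hv.1) ((apply_mem_ker_Ycomp V y).1 hv.2)
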